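/- Let A be a nonzero m×n real matrix and θ > 0. Nonzero matrices X feasible for the primal problem (maximize ⟨A,X⟩ subject to ‖X‖_θ ≤ 1) and (Y,Z) feasible for the dual problem (Y + Z = A) are respectively optimal for these two problems if and only if: (i) ‖Y‖ = θ⁻¹‖Z‖_∞; (ii) X ∈ α·∂‖Y‖ for some α ≥ 0; (iii) X ∈ β·∂‖Z‖_∞ for some β ≥ 0; and (iv) α + θβ = 1. Here ∂‖Y‖ is the subdifferential of the spectral norm at Y and ∂‖Z‖_∞ is the subdifferential of the entrywise max norm at Z. -/

import Mathlib

open scoped BigOperators Pointwise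

noncomputable section

namespace LAROS

variable {m n : ℕ}

/-- Trace inner product `⟨A,X⟩ = trace(Aᵀ X)`. -/
def mInner (A X : Matrix (Fin m) (Fin n) ℝ) : ℝ := ∑ i, ∑ j, A i j * X i j

/-- `N` is a norm on `m×n` real matrices. -/
def IsMatrixNorm (N : Matrix (Fin m) (Fin n) ℝ → ℝ) : Prop :=
  (∀ X, N X = 0 ↔ X = 0) ∧ (∀ (c : ℝ) (X), N (c • X) = |c| * N X) ∧
    (∀ X Y, N (X + Y) ≤ N X + N Y)

/-- Dual norm of `N`. -/
def dualNorm (N : Matrix (Fin m) (Fin n) ℝ → ℝ) (A : Matrix (Fin m) (Fin n) ℝ) : ℝ :=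
  sSup {r | ∃ Y, N Y ≤ 1 ∧ r = mInner A Y}

/-- `X` is optimal for: minimize `N X` subject to `⟨A,X⟩ ≥ 1`. -/
def IsOptMin (N : Matrix (Fin m) (Fin n) ℝ → ℝ) (A X : Matrix (Fin m) (Fin n) ℝ) : Prop :=
  1 ≤ mInner A X ∧ ∀ X', 1 ≤ mInner A X' → N X ≤ N X'

/-- `Y` is optimal for: maximize `⟨A,Y⟩` subject to `N Y ≤ 1`. -/
def IsOptMax (N : Matrix (Fin m) (Fin n) ℝ → ℝ) (A Y : Matrix (Fin m) (Fin n) ℝ) : Prop :=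
  N Y ≤ 1 ∧ ∀ Y', N Y' ≤ 1 → mInner A Y' ≤ mInner A Y

/-- Subdifferential of `f : ℝ^{m×n} → ℝ` at `A`, with respect to the trace inner product. -/
def subdiff (f : Matrix (Fin m) (Fin n) ℝ → ℝ) (A : Matrix (Fin m) (Fin n) ℝ) :
    Set (Matrix (Fin m) (Fin n) ℝ) :=
  {Y | ∀ B, f A + mInner (B - A) Y ≤ f B}

/-- The spectral norm (largest singular value) of an `m×n` real matrix. -/
def spectralNorm (A : Matrix (Fin m) (Fin n) ℝ) : ℝ :=
  sSup {r | ∃ (u : Fin m → ℝ) (v : Fin n → ℝ),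
    (∑ i, u i ^ 2) ≤ 1 ∧ (∑ j, v j ^ 2) ≤ 1 ∧ r = ∑ i, ∑ j, u i * A i j * v j}

/-- The nuclear norm (sum of singular values), as the dual norm of the spectral norm. -/
def nuclearNorm (A : Matrix (Fin m) (Fin n) ℝ) : ℝ := dualNorm spectralNorm A

/-- Entrywise ℓ1 norm: sum of absolute values of all entries. -/
def l1Norm (X : Matrix (Fin m) (Fin n) ℝ) : ℝ := ∑ i, ∑ j, |X i j|

/-- Entrywise max norm: maximum absolute value of an entry. -/
def maxNorm (X : Matrix (Fin m) (Fin n) ℝ) : ℝ := sSup {r | ∃ i j, r = |X i j|}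

/-- The norm `‖X‖_θ = ‖X‖_* + θ‖X‖₁`. -/
def thetaNorm (θ : ℝ) (X : Matrix (Fin m) (Fin n) ℝ) : ℝ := nuclearNorm X + θ * l1Norm X

/-- `(Y,Z)` is optimal for the dual problem: minimize `max{‖Y‖, θ⁻¹‖Z‖_∞}`
subject to `Y + Z = A`. -/
def IsOptDual (θ : ℝ) (A Y Z : Matrix (Fin m) (Fin n) ℝ) : Prop :=
  Y + Z = A ∧ ∀ Y' Z' : Matrix (Fin m) (Fin n) ℝ, Y' + Z' = A →
    max (spectralNorm Y) (θ⁻¹ * maxNorm Z) ≤ max (spectralNorm Y') (θ⁻¹ * maxNorm Z')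

theorem mInner_comm (A X : Matrix (Fin m) (Fin n) ℝ) : mInner A X = mInner X A := by
  simp only [mInner, mul_comm]

theorem mInner_add_left (A B X : Matrix (Fin m) (Fin n) ℝ) :
    mInner (A + B) X = mInner A X + mInner B X := by
  simp only [mInner, Matrix.add_apply, add_mul, Finset.sum_add_distrib]

theorem mInner_sub_left (A B X : Matrix (Fin m) (Fin n) ℝ) :
    mInner (A - B) X = mInner A X - mInner B X := by
  simp only [mInner, Matrix.sub_apply, sub_mul, Finset.sum_sub_distrib]

theorem mInner_smul_left (c : ℝ) (A X : Matrix (Fin m) (Fin n) ℝ) :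
    mInner (c • A) X = c * mInner A X := by
  simp only [mInner, Matrix.smul_apply, smul_eq_mul, mul_assoc, Finset.mul_sum]

theorem mInner_smul_right (c : ℝ) (A X : Matrix (Fin m) (Fin n) ℝ) :
    mInner A (c • X) = c * mInner A X := by
  rw [mInner_comm, mInner_smul_left, mInner_comm]

theorem mInner_zero_left (X : Matrix (Fin m) (Fin n) ℝ) : mInner 0 X = 0 := by
  simp [mInner]

theorem mInner_self_pos {X : Matrix (Fin m) (Fin n) ℝ} (hX : X ≠ 0) : 0 < mInner X X := by
  obtain ⟨i, j, hij⟩ : ∃ i j, X i j ≠ 0 := by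
    by_contra! h
    exact hX (Matrix.ext h)
  exact Finset.sum_pos' (fun i _ => Finset.sum_nonneg fun j _ => mul_self_nonneg _)
    ⟨i, Finset.mem_univ i, Finset.sum_pos' (fun j _ => mul_self_nonneg _)
      ⟨j, Finset.mem_univ j, mul_self_pos.2 hij⟩⟩

/-- Every linear functional on matrices is a trace inner product. -/
theorem exists_eq_mInner (f : Matrix (Fin m) (Fin n) ℝ →ₗ[ℝ] ℝ) :
    ∃ W, ∀ B, f B = mInner B W := by
  refine ⟨Matrix.of fun i j => f (Matrix.single i j 1), fun B => ?_⟩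
  conv_lhs => rw [Matrix.matrix_eq_sum_single B]
  simp only [map_sum, mInner, Matrix.of_apply]
  refine Finset.sum_congr rfl fun i _ => Finset.sum_congr rfl fun j _ => ?_
  rw [← smul_eq_mul, ← map_smul, Matrix.smul_single, smul_eq_mul, mul_one]

section Norm

variable {N : Matrix (Fin m) (Fin n) ℝ → ℝ}

theorem IsMatrixNorm.map_zero (hN : IsMatrixNorm N) : N 0 = 0 := (hN.1 0).2 rfl

theorem IsMatrixNorm.nonneg (hN : IsMatrixNorm N) (X : Matrix (Fin m) (Fin n) ℝ) : 0 ≤ N X := by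
  have h := hN.2.2 X ((-1 : ℝ) • X)
  rw [hN.2.1, neg_one_smul, add_neg_cancel, hN.map_zero] at h
  norm_num at h
  linarith

theorem IsMatrixNorm.pos (hN : IsMatrixNorm N) {X : Matrix (Fin m) (Fin n) ℝ} (hX : X ≠ 0) :
    0 < N X :=
  (hN.nonneg X).lt_of_ne fun h => hX ((hN.1 X).1 h.symm)

/-- A subadditive, subhomogeneous function dominating the entries is a norm. -/
theorem isMatrixNorm_of_le (hent : ∀ X i j, |X i j| ≤ N X) (hnn : ∀ X, 0 ≤ N X)
    (hsmul : ∀ (c : ℝ) (X), N (c • X) ≤ |c| * N X) (hadd : ∀ X Y, N (X + Y) ≤ N X + N Y) :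
    IsMatrixNorm N := by
  have hzero : N 0 = 0 := le_antisymm (by simpa using hsmul 0 0) (hnn 0)
  refine ⟨fun X => ⟨fun h => ?_, fun h => h ▸ hzero⟩, fun c X => ?_, hadd⟩
  · ext i j
    exact abs_nonpos_iff.1 (h ▸ hent X i j)
  · refine le_antisymm (hsmul c X) ?_
    rcases eq_or_ne c 0 with rfl | hc
    · simp [hzero]
    · have h := hsmul c⁻¹ (c • X)
      rw [smul_smul, inv_mul_cancel₀ hc, one_smul, abs_inv] at h
      rwa [← le_inv_mul_iff₀ (abs_pos.2 hc)]

theorem IsMatrixNorm.convexOn (hN : IsMatrixNorm N) : ConvexOn ℝ Set.univ N := by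
  refine ⟨convex_univ, fun X _ Y _ a b ha hb _ => (hN.2.2 _ _).trans ?_⟩
  rw [hN.2.1, hN.2.1, abs_of_nonneg ha, abs_of_nonneg hb, smul_eq_mul, smul_eq_mul]

theorem IsMatrixNorm.continuous (hN : IsMatrixNorm N) : Continuous N :=
  (ConvexOn.locallyLipschitz (E := Fin m → Fin n → ℝ) hN.convexOn).continuous

theorem IsMatrixNorm.mem_subdiff_iff (hN : IsMatrixNorm N) {A U : Matrix (Fin m) (Fin n) ℝ} :
    U ∈ subdiff N A ↔ mInner A U = N A ∧ ∀ B, mInner B U ≤ N B := by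
  constructor
  · intro h
    have h0 := h 0
    have h2 := h ((2 : ℝ) • A)
    rw [hN.map_zero, mInner_sub_left, mInner_zero_left] at h0
    rw [hN.2.1, mInner_sub_left, mInner_smul_left, abs_two] at h2
    refine ⟨by linarith, fun B => ?_⟩
    have hB := h B
    rw [mInner_sub_left] at hB
    linarith
  · rintro ⟨hA, h⟩ B
    rw [mInner_sub_left]
    linarith [h B]

theorem bddAbove_dualNorm (hent : ∀ X i j, |X i j| ≤ N X) (X : Matrix (Fin m) (Fin n) ℝ) :
    BddAbove {r | ∃ Y, N Y ≤ 1 ∧ r = mInner X Y} := by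
  refine ⟨l1Norm X, ?_⟩
  rintro _ ⟨Y, hY, rfl⟩
  refine Finset.sum_le_sum fun i _ => Finset.sum_le_sum fun j _ => (le_abs_self _).trans ?_
  rw [abs_mul]
  exact mul_le_of_le_one_right (abs_nonneg _) ((hent Y i j).trans hY)

theorem IsMatrixNorm.mInner_le_mul_dualNorm (hN : IsMatrixNorm N)
    (hent : ∀ X i j, |X i j| ≤ N X) (A X : Matrix (Fin m) (Fin n) ℝ) :
    mInner A X ≤ N A * dualNorm N X := by
  rcases eq_or_ne A 0 with rfl | hA
  · simp [mInner_zero_left, hN.map_zero]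
  · have hpos := hN.pos hA
    have h : mInner X ((N A)⁻¹ • A) ≤ dualNorm N X := by
      refine le_csSup (bddAbove_dualNorm hent X) ⟨_, ?_, rfl⟩
      rw [hN.2.1, abs_of_pos (inv_pos.2 hpos), inv_mul_cancel₀ hpos.ne']
    rwa [mInner_smul_right, inv_mul_le_iff₀ hpos, mInner_comm] at h

theorem IsMatrixNorm.dualNorm_pos (hN : IsMatrixNorm N) (hent : ∀ X i j, |X i j| ≤ N X)
    {X : Matrix (Fin m) (Fin n) ℝ} (hX : X ≠ 0) : 0 < dualNorm N X :=
  pos_of_mul_pos_right ((mInner_self_pos hX).trans_le (hN.mInner_le_mul_dualNorm hent X X))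
    (hN.nonneg X)

theorem IsMatrixNorm.dualNorm_nonneg (hN : IsMatrixNorm N) (hent : ∀ X i j, |X i j| ≤ N X)
    (X : Matrix (Fin m) (Fin n) ℝ) : 0 ≤ dualNorm N X :=
  le_csSup (bddAbove_dualNorm hent X)
    ⟨0, hN.map_zero.trans_le zero_le_one, by rw [mInner_comm, mInner_zero_left]⟩

theorem IsMatrixNorm.dualNorm_le (hN : IsMatrixNorm N) {X : Matrix (Fin m) (Fin n) ℝ} {c : ℝ}
    (h : ∀ Y, N Y ≤ 1 → mInner Y X ≤ c) : dualNorm N X ≤ c := by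
  refine csSup_le ⟨_, 0, hN.map_zero.trans_le zero_le_one, rfl⟩ ?_
  rintro _ ⟨Y, hY, rfl⟩
  exact mInner_comm X Y ▸ h Y hY

theorem IsMatrixNorm.dualNorm_smul_le (hN : IsMatrixNorm N) (hent : ∀ X i j, |X i j| ≤ N X)
    {c : ℝ} (hc : 0 ≤ c) (X : Matrix (Fin m) (Fin n) ℝ) :
    dualNorm N (c • X) ≤ c * dualNorm N X := by
  refine hN.dualNorm_le fun Y hY => ?_
  rw [mInner_smul_right]
  exact mul_le_mul_of_nonneg_left ((hN.mInner_le_mul_dualNorm hent Y X).trans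
    (mul_le_of_le_one_left (hN.dualNorm_nonneg hent X) hY)) hc

/-- Equality in the duality inequality puts `X` in the scaled subdifferential. -/
theorem IsMatrixNorm.mem_smul_subdiff (hN : IsMatrixNorm N) (hent : ∀ X i j, |X i j| ≤ N X)
    {X Y : Matrix (Fin m) (Fin n) ℝ} (hX : X ≠ 0) (h : mInner Y X = N Y * dualNorm N X) :
    X ∈ dualNorm N X • subdiff N Y := by
  have hpos := hN.dualNorm_pos hent hX
  refine Set.mem_smul_set.2 ⟨(dualNorm N X)⁻¹ • X, hN.mem_subdiff_iff.2 ⟨?_, fun B => ?_⟩,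
    by rw [smul_smul, mul_inv_cancel₀ hpos.ne', one_smul]⟩
  · rw [mInner_smul_right, h]
    field_simp
  · rw [mInner_smul_right, inv_mul_le_iff₀ hpos, mul_comm]
    exact hN.mInner_le_mul_dualNorm hent B X

theorem IsMatrixNorm.mInner_of_mem_smul_subdiff (hN : IsMatrixNorm N)
    {X Y : Matrix (Fin m) (Fin n) ℝ} {α : ℝ} (h : X ∈ α • subdiff N Y) :
    mInner Y X = α * N Y := by
  obtain ⟨U, hU, rfl⟩ := Set.mem_smul_set.1 h
  rw [mInner_smul_right, (hN.mem_subdiff_iff.1 hU).1]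

/-- Separation of `A` from the sum of two open norm balls. -/
theorem IsMatrixNorm.exists_separating {N₁ N₂ : Matrix (Fin m) (Fin n) ℝ → ℝ}
    (h₁ : IsMatrixNorm N₁) (h₂ : IsMatrixNorm N₂) {p q : ℝ} (hp : 0 < p) (hq : 0 < q)
    {A : Matrix (Fin m) (Fin n) ℝ} (hA : ∀ Y Z, Y + Z = A → N₁ Y < p → q ≤ N₂ Z) :
    ∃ W, 0 < mInner A W ∧ p * dualNorm N₁ W + q * dualNorm N₂ W ≤ mInner A W := by
  have hconv : Convex ℝ ({Y | N₁ Y < p} + {Z | N₂ Z < q}) := by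
    refine Convex.add ?_ ?_
    · simpa using h₁.convexOn.convex_lt p
    · simpa using h₂.convexOn.convex_lt q
  have hopen : IsOpen ({Y | N₁ Y < p} + {Z | N₂ Z < q}) :=
    (isOpen_lt h₁.continuous continuous_const).add_right
  have hmem : A ∉ {Y | N₁ Y < p} + {Z | N₂ Z < q} := by
    rintro ⟨Y, hY, Z, hZ, hYZ⟩
    exact (hA Y Z hYZ hY).not_gt hZ
  have : LocallyConvexSpace ℝ (Matrix (Fin m) (Fin n) ℝ) :=
    inferInstanceAs (LocallyConvexSpace ℝ (Fin m → Fin n → ℝ))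
  obtain ⟨f, hf⟩ := geometric_hahn_banach_open_point hconv hopen hmem
  obtain ⟨W, hW⟩ := exists_eq_mInner f.toLinearMap
  have hsep : ∀ Y Z, N₁ Y < p → N₂ Z < q → mInner Y W + mInner Z W < mInner A W := by
    intro Y Z hY hZ
    rw [← mInner_add_left, ← hW, ← hW]
    exact hf _ (Set.add_mem_add hY hZ)
  have hpos : 0 < mInner A W := by
    simpa [mInner_zero_left] using
      hsep 0 0 (h₁.map_zero.trans_lt hp) (h₂.map_zero.trans_lt hq)
  have hball : ∀ U V, N₁ U ≤ 1 → N₂ V ≤ 1 →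
      p * mInner U W + q * mInner V W ≤ mInner A W := by
    intro U V hU hV
    by_contra! hlt
    set x := p * mInner U W + q * mInner V W
    have hx : 0 < x := hpos.trans hlt
    set t := mInner A W / x
    have ht0 : 0 < t := div_pos hpos hx
    have ht1 : t < 1 := (div_lt_one hx).2 hlt
    have hscale : ∀ {r s : ℝ}, 0 < r → 0 ≤ s → s ≤ 1 → |t * r| * s < r := by
      intro r s hr hs hs1
      rw [abs_of_pos (mul_pos ht0 hr)]
      nlinarith [mul_pos ht0 hr]
    have h := hsep ((t * p) • U) ((t * q) • V)
      (by rw [h₁.2.1]; exact hscale hp (h₁.nonneg U) hU)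
      (by rw [h₂.2.1]; exact hscale hq (h₂.nonneg V) hV)
    rw [mInner_smul_left, mInner_smul_left] at h
    have hx' : t * x = mInner A W := div_mul_cancel₀ _ hx.ne'
    have : t * x = t * p * mInner U W + t * q * mInner V W := by simp only [x]; ring
    linarith
  refine ⟨W, hpos, ?_⟩
  have hdual₂ : dualNorm N₂ W ≤ (mInner A W - p * dualNorm N₁ W) / q := by
    refine h₂.dualNorm_le fun V hV => ?_
    have hdual₁ : dualNorm N₁ W ≤ (mInner A W - q * mInner V W) / p := by
      refine h₁.dualNorm_le fun U hU => ?_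
      rw [le_div_iff₀ hp]
      linarith [hball U V hU hV]
    rw [le_div_iff₀ hp] at hdual₁
    rw [le_div_iff₀ hq]
    linarith
  rw [le_div_iff₀ hq] at hdual₂
  linarith

end Norm

theorem abs_le_maxNorm (X : Matrix (Fin m) (Fin n) ℝ) (i : Fin m) (j : Fin n) :
    |X i j| ≤ maxNorm X := by
  refine le_csSup ⟨l1Norm X, ?_⟩ ⟨i, j, rfl⟩
  rintro _ ⟨i, j, rfl⟩
  exact (Finset.single_le_sum (f := fun j => |X i j|) (fun _ _ => abs_nonneg _)
    (Finset.mem_univ j)).trans (Finset.single_le_sum (f := fun i => ∑ j, |X i j|)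
      (fun _ _ => Finset.sum_nonneg fun _ _ => abs_nonneg _) (Finset.mem_univ i))

theorem maxNorm_le {X : Matrix (Fin m) (Fin n) ℝ} {c : ℝ} (hc : 0 ≤ c)
    (h : ∀ i j, |X i j| ≤ c) : maxNorm X ≤ c := by
  refine Real.sSup_le ?_ hc
  rintro _ ⟨i, j, rfl⟩
  exact h i j

theorem isMatrixNorm_maxNorm : IsMatrixNorm (maxNorm (m := m) (n := n)) := by
  have hnn : ∀ X : Matrix (Fin m) (Fin n) ℝ, 0 ≤ maxNorm X := by
    refine fun X => Real.sSup_nonneg ?_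
    rintro _ ⟨i, j, rfl⟩
    exact abs_nonneg _
  refine isMatrixNorm_of_le abs_le_maxNorm hnn (fun c X => ?_) (fun X Y => ?_)
  · refine maxNorm_le (mul_nonneg (abs_nonneg _) (hnn X)) fun i j => ?_
    rw [Matrix.smul_apply, smul_eq_mul, abs_mul]
    exact mul_le_mul_of_nonneg_left (abs_le_maxNorm X i j) (abs_nonneg c)
  · exact maxNorm_le (add_nonneg (hnn X) (hnn Y)) fun i j =>
      (abs_add_le _ _).trans (add_le_add (abs_le_maxNorm X i j) (abs_le_maxNorm Y i j))

/-- The entrywise `ℓ1` norm is dual to the entrywise max norm. -/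
theorem dualNorm_maxNorm (X : Matrix (Fin m) (Fin n) ℝ) : dualNorm maxNorm X = l1Norm X := by
  refine le_antisymm (isMatrixNorm_maxNorm.dualNorm_le fun Y hY => ?_) ?_
  · refine Finset.sum_le_sum fun i _ => Finset.sum_le_sum fun j _ => (le_abs_self _).trans ?_
    rw [abs_mul]
    exact mul_le_of_le_one_left (abs_nonneg _) ((abs_le_maxNorm Y i j).trans hY)
  · refine le_csSup (bddAbove_dualNorm abs_le_maxNorm X)
      ⟨Matrix.of fun i j => (SignType.sign (X i j) : ℝ), maxNorm_le zero_le_one fun i j => ?_, ?_⟩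
    · rw [Matrix.of_apply]
      cases SignType.sign (X i j) <;> simp
    · simp only [l1Norm, mInner, Matrix.of_apply, self_mul_sign]

theorem abs_le_one_of_sum_sq_le_one {k : ℕ} {u : Fin k → ℝ} (hu : ∑ i, u i ^ 2 ≤ 1) (i : Fin k) :
    |u i| ≤ 1 := by
  rw [← sq_le_one_iff_abs_le_one]
  exact (Finset.single_le_sum (f := fun i => u i ^ 2) (fun _ _ => sq_nonneg _)
    (Finset.mem_univ i)).trans hu

theorem le_spectralNorm (A : Matrix (Fin m) (Fin n) ℝ) {u : Fin m → ℝ} {v : Fin n → ℝ}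
    (hu : ∑ i, u i ^ 2 ≤ 1) (hv : ∑ j, v j ^ 2 ≤ 1) :
    ∑ i, ∑ j, u i * A i j * v j ≤ spectralNorm A := by
  refine le_csSup ⟨l1Norm A, ?_⟩ ⟨u, v, hu, hv, rfl⟩
  rintro _ ⟨u, v, hu, hv, rfl⟩
  refine Finset.sum_le_sum fun i _ => Finset.sum_le_sum fun j _ => (le_abs_self _).trans ?_
  rw [abs_mul, abs_mul]
  exact (mul_le_of_le_one_right (by positivity) (abs_le_one_of_sum_sq_le_one hv j)).trans
    (mul_le_of_le_one_left (abs_nonneg _) (abs_le_one_of_sum_sq_le_one hu i))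

theorem spectralNorm_le {A : Matrix (Fin m) (Fin n) ℝ} {c : ℝ}
    (h : ∀ (u : Fin m → ℝ) (v : Fin n → ℝ), ∑ i, u i ^ 2 ≤ 1 → ∑ j, v j ^ 2 ≤ 1 →
      ∑ i, ∑ j, u i * A i j * v j ≤ c) : spectralNorm A ≤ c := by
  refine csSup_le ⟨_, 0, 0, by simp, by simp, rfl⟩ ?_
  rintro _ ⟨u, v, hu, hv, rfl⟩
  exact h u v hu hv

theorem spectralNorm_nonneg (A : Matrix (Fin m) (Fin n) ℝ) : 0 ≤ spectralNorm A := by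
  simpa using le_spectralNorm A (u := 0) (v := 0) (by simp) (by simp)

theorem abs_sum_le_spectralNorm (A : Matrix (Fin m) (Fin n) ℝ) {u : Fin m → ℝ} {v : Fin n → ℝ}
    (hu : ∑ i, u i ^ 2 ≤ 1) (hv : ∑ j, v j ^ 2 ≤ 1) :
    |∑ i, ∑ j, u i * A i j * v j| ≤ spectralNorm A := by
  refine abs_le'.2 ⟨le_spectralNorm A hu hv, ?_⟩
  simpa using le_spectralNorm A (u := -u) (by simpa using hu) hv

theorem abs_le_spectralNorm (A : Matrix (Fin m) (Fin n) ℝ) (i : Fin m) (j : Fin n) :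
    |A i j| ≤ spectralNorm A := by
  have h := abs_sum_le_spectralNorm A (u := Pi.single i 1) (v := Pi.single j 1)
    (by simp [Pi.single_apply]) (by simp [Pi.single_apply])
  simpa [Pi.single_apply] using h

theorem isMatrixNorm_spectralNorm : IsMatrixNorm (spectralNorm (m := m) (n := n)) := by
  refine isMatrixNorm_of_le abs_le_spectralNorm spectralNorm_nonneg (fun c X => ?_)
    (fun X Y => ?_)
  · refine spectralNorm_le fun u v hu hv => ?_
    have h : ∑ i, ∑ j, u i * (c • X) i j * v j = c * ∑ i, ∑ j, u i * X i j * v j := by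
      simp only [Finset.mul_sum, Matrix.smul_apply, smul_eq_mul]
      refine Finset.sum_congr rfl fun i _ => Finset.sum_congr rfl fun j _ => by ring
    rw [h]
    refine (le_abs_self _).trans ?_
    rw [abs_mul]
    exact mul_le_mul_of_nonneg_left (abs_sum_le_spectralNorm X hu hv) (abs_nonneg c)
  · refine spectralNorm_le fun u v hu hv => ?_
    simp only [Matrix.add_apply, mul_add, add_mul, Finset.sum_add_distrib]
    exact add_le_add (le_spectralNorm X hu hv) (le_spectralNorm Y hu hv)

theorem thetaNorm_eq (θ : ℝ) (X : Matrix (Fin m) (Fin n) ℝ) :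
    thetaNorm θ X = dualNorm spectralNorm X + θ * dualNorm maxNorm X := by
  rw [dualNorm_maxNorm]
  rfl

/-- Weak duality. -/
theorem mInner_le_of_thetaNorm_le_one {θ : ℝ} (hθ : 0 < θ) {A X Y Z : Matrix (Fin m) (Fin n) ℝ}
    (hX : thetaNorm θ X ≤ 1) (hYZ : Y + Z = A) :
    mInner A X ≤ max (spectralNorm Y) (θ⁻¹ * maxNorm Z) := by
  set p := max (spectralNorm Y) (θ⁻¹ * maxNorm Z)
  have hY : spectralNorm Y ≤ p := le_max_left _ _
  have hZ : maxNorm Z ≤ θ * p := by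
    rw [← inv_mul_le_iff₀ hθ]
    exact le_max_right _ _
  have hp : 0 ≤ p := (spectralNorm_nonneg Y).trans hY
  have hY' := isMatrixNorm_spectralNorm.mInner_le_mul_dualNorm abs_le_spectralNorm Y X
  have hZ' := isMatrixNorm_maxNorm.mInner_le_mul_dualNorm abs_le_maxNorm Z X
  have hY'' := mul_le_mul_of_nonneg_right hY
    (isMatrixNorm_spectralNorm.dualNorm_nonneg abs_le_spectralNorm X)
  have hZ'' := mul_le_mul_of_nonneg_right hZ (isMatrixNorm_maxNorm.dualNorm_nonneg abs_le_maxNorm X)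
  have hX' := mul_le_mul_of_nonneg_left hX hp
  rw [thetaNorm_eq] at hX'
  rw [← hYZ, mInner_add_left]
  linarith

/-- Strong duality: the dual optimal value is attained by a primal feasible matrix. -/
theorem exists_thetaNorm_le_one_of_isOptDual {θ : ℝ} (hθ : 0 < θ)
    {A Y Z : Matrix (Fin m) (Fin n) ℝ} (hopt : IsOptDual θ A Y Z)
    (hp : 0 < max (spectralNorm Y) (θ⁻¹ * maxNorm Z)) :
    ∃ X, thetaNorm θ X ≤ 1 ∧ max (spectralNorm Y) (θ⁻¹ * maxNorm Z) ≤ mInner A X := by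
  set p := max (spectralNorm Y) (θ⁻¹ * maxNorm Z)
  obtain ⟨W, hpos, hW⟩ := isMatrixNorm_spectralNorm.exists_separating isMatrixNorm_maxNorm hp
    (mul_pos hθ hp) (A := A) fun Y' Z' hYZ' hY' => by
      rw [← le_inv_mul_iff₀ hθ]
      exact ((le_max_iff.1 (hopt.2 Y' Z' hYZ')).resolve_left hY'.not_ge)
  have hW0 : W ≠ 0 := by
    rintro rfl
    rw [mInner_comm, mInner_zero_left] at hpos
    exact hpos.false
  have hN : 0 < thetaNorm θ W := by
    rw [thetaNorm_eq]
    exact add_pos_of_pos_of_nonneg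
      (isMatrixNorm_spectralNorm.dualNorm_pos abs_le_spectralNorm hW0)
      (mul_nonneg hθ.le (isMatrixNorm_maxNorm.dualNorm_nonneg abs_le_maxNorm W))
  refine ⟨(thetaNorm θ W)⁻¹ • W, ?_, ?_⟩
  · have hc := (inv_pos.2 hN).le
    rw [thetaNorm_eq θ (_ • W), ← inv_mul_cancel₀ hN.ne']
    have h₁ := isMatrixNorm_spectralNorm.dualNorm_smul_le abs_le_spectralNorm hc W
    have h₂ := mul_le_mul_of_nonneg_left
      (isMatrixNorm_maxNorm.dualNorm_smul_le abs_le_maxNorm hc W) hθ.le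
    have h₃ : (thetaNorm θ W)⁻¹ * thetaNorm θ W = (thetaNorm θ W)⁻¹ * dualNorm spectralNorm W +
        θ * ((thetaNorm θ W)⁻¹ * dualNorm maxNorm W) := by
      nth_rw 2 [thetaNorm_eq θ W]
      ring
    linarith
  · rw [mInner_smul_right, le_inv_mul_iff₀ hN, thetaNorm_eq]
    linarith

theorem stmt8 (θ : ℝ) (hθ : 0 < θ) (A : Matrix (Fin m) (Fin n) ℝ) (hA : A ≠ 0)
    (X Y Z : Matrix (Fin m) (Fin n) ℝ) (hX0 : X ≠ 0) (hYZ0 : ¬(Y = 0 ∧ Z = 0))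
    (hXfeas : thetaNorm θ X ≤ 1) (hYZfeas : Y + Z = A) :
    (IsOptMax (thetaNorm θ) A X ∧ IsOptDual θ A Y Z) ↔
      (spectralNorm Y = θ⁻¹ * maxNorm Z ∧
        ∃ α β : ℝ, 0 ≤ α ∧ 0 ≤ β ∧
          X ∈ α • subdiff spectralNorm Y ∧ X ∈ β • subdiff maxNorm Z ∧
          α + θ * β = 1) := by
  have hsn := isMatrixNorm_spectralNorm (m := m) (n := n)
  have hmn := isMatrixNorm_maxNorm (m := m) (n := n)
  constructor
  · rintro ⟨hprimal, hdual⟩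
    set p := max (spectralNorm Y) (θ⁻¹ * maxNorm Z)
    have hYp : spectralNorm Y ≤ p := le_max_left _ _
    have hZp : maxNorm Z ≤ θ * p := by
      rw [← inv_mul_le_iff₀ hθ]
      exact le_max_right _ _
    have hp : 0 < p := by
      by_cases hY : Y = 0
      · exact lt_max_of_lt_right (mul_pos (inv_pos.2 hθ) (hmn.pos fun hZ => hYZ0 ⟨hY, hZ⟩))
      · exact lt_max_of_lt_left (hsn.pos hY)
    obtain ⟨X', hX', hpX'⟩ := exists_thetaNorm_le_one_of_isOptDual hθ hdual hp
    have hpX : p ≤ mInner A X := hpX'.trans (hprimal.2 X' hX')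
    rw [← hYZfeas, mInner_add_left] at hpX
    have hα := hsn.dualNorm_pos abs_le_spectralNorm hX0
    have hβ := hmn.dualNorm_pos abs_le_maxNorm hX0
    have hYX := hsn.mInner_le_mul_dualNorm abs_le_spectralNorm Y X
    have hZX := hmn.mInner_le_mul_dualNorm abs_le_maxNorm Z X
    have hYX' := mul_le_mul_of_nonneg_right hYp hα.le
    have hZX' := mul_le_mul_of_nonneg_right hZp hβ.le
    rw [thetaNorm_eq] at hXfeas
    have hXp := mul_le_mul_of_nonneg_left hXfeas hp.le
    have hYeq : spectralNorm Y = p := mul_right_cancel₀ hα.ne' (by linarith)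
    have hZeq : maxNorm Z = θ * p := mul_right_cancel₀ hβ.ne' (by linarith)
    refine ⟨by rw [hYeq, hZeq, inv_mul_cancel_left₀ hθ.ne'], dualNorm spectralNorm X,
      dualNorm maxNorm X, hα.le, hβ.le,
      hsn.mem_smul_subdiff abs_le_spectralNorm hX0 (by linarith),
      hmn.mem_smul_subdiff abs_le_maxNorm hX0 (by linarith),
      mul_left_cancel₀ hp.ne' (by linarith)⟩
  · rintro ⟨heq, α, β, -, -, hα, hβ, hαβ⟩
    have hval : mInner A X = max (spectralNorm Y) (θ⁻¹ * maxNorm Z) := by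
      have hZ : maxNorm Z = θ * spectralNorm Y := by rw [heq, mul_inv_cancel_left₀ hθ.ne']
      rw [← heq, max_self, ← hYZfeas, mInner_add_left, hsn.mInner_of_mem_smul_subdiff hα,
        hmn.mInner_of_mem_smul_subdiff hβ, hZ]
      linear_combination spectralNorm Y * hαβ
    exact ⟨⟨hXfeas, fun X' hX' => hval ▸ mInner_le_of_thetaNorm_le_one hθ hX' hYZfeas⟩,
      hYZfeas, fun Y' Z' hYZ' => hval ▸ mInner_le_of_thetaNorm_le_one hθ hXfeas hYZ'⟩

end LAROS
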